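/- In ℚ[x,y,z], let M̃ be the 4×4 matrix ½·[(8z², y, −x, 0); (y, −32z, −9y, 8x); (−x, −9y, 10x, 8z); (0, 8x, 8z, −8y)] and let W = −80x³ + 81y³ + 176xyz + 256z³. Then ¼·det M̃ = (yz−x²)² − xy³ + W·z². (This determinant is the equation of the superisolated singularity of degree 4 whose universal abelian cover has embedding dimension 12.) -/

import Mathlib

open MvPolynomial Matrix

namespace Stmt14

noncomputable section

def x : MvPolynomial (Fin 3) ℚ := X 0
def y : MvPolynomial (Fin 3) ℚ := X 1
def z : MvPolynomial (Fin 3) ℚ := X 2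

/-- The perturbed matrix `M̃`, one half times the displayed matrix. -/
def Mt : Matrix (Fin 4) (Fin 4) (MvPolynomial (Fin 3) ℚ) :=
  (C (1 / 2 : ℚ) : MvPolynomial (Fin 3) ℚ) •
    !![8 * z ^ 2, y, -x, 0;
       y, -32 * z, -9 * y, 8 * x;
       -x, -9 * y, 10 * x, 8 * z;
       0, 8 * x, 8 * z, -8 * y]

/-- The cubic `W` cutting out four times the divisor `D`. -/
def W : MvPolynomial (Fin 3) ℚ :=
  -80 * x ^ 3 + 81 * y ^ 3 + 176 * x * y * z + 256 * z ^ 3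

/-- `¼·det M̃ = (yz−x²)² − xy³ + W·z²`. -/
theorem stmt14 :
    C (1 / 4 : ℚ) * Mt.det = (y * z - x ^ 2) ^ 2 - x * y ^ 3 + W * z ^ 2 := by
  have hdet : Mt.det =
      C (1 / 2 : ℚ) ^ 4 * (64 * ((y * z - x ^ 2) ^ 2 - x * y ^ 3 + W * z ^ 2)) := by
    rw [Mt, det_smul, Fintype.card_fin]
    congr 1
    simp [det_succ_row_zero, Fin.sum_univ_succ, Fin.succAbove, W]
    ring
  have hconst : (C (1 / 4 : ℚ) * C (1 / 2 : ℚ) ^ 4 * 64 : MvPolynomial (Fin 3) ℚ) = 1 := by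
    rw [← map_ofNat (C : ℚ →+* MvPolynomial (Fin 3) ℚ) 64, ← map_pow, ← map_mul, ← map_mul,
      ← map_one C]
    norm_num
  rw [hdet]
  linear_combination ((y * z - x ^ 2) ^ 2 - x * y ^ 3 + W * z ^ 2) * hconst

end

end Stmt14
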